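/- Let x ∈ (0,1) be irrational and let j ≥ 0 be such that a := a_{j+1} ≥ 2. For 0 ≤ λ < a write m_λ := (λ p_j + p_{j−1})/(λ q_j + q_{j−1}), and set m_a := p_j/q_j. Then for every 0 ≤ λ ≤ a with (j, λ) ≠ (0, 0): 0 < Θ(x, m_λ) < (a+2)/4 if a is even, and 0 < Θ(x, m_λ) < (a+1)(a+3)/(4(a+2)) if a is odd. Moreover, Θ(x, m_λ) < Θ(x, m_{λ'}) for all 0 ≤ λ < λ' ≤ ⌊a/2⌋, and Θ(x, m_λ) > Θ(x, m_{λ'}) > Θ(x, p_j/q_j) for all ⌈a/2⌉ ≤ λ < λ' < a. -/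

import Mathlib

open MeasureTheory Filter Topology
open scoped Classical

noncomputable section

/-- The Farey tent map `F`. -/
def fareyMap (x : ℝ) : ℝ := if x ≤ 1/2 then x / (1 - x) else (1 - x) / x

/-- `eps x n = ε_{n+1}(x)`, i.e. `0` if `F^[n] x ≤ 1/2` and `1` otherwise. -/
def eps (x : ℝ) (n : ℕ) : ℤ := if fareyMap^[n] x ≤ 1/2 then 0 else 1

/-- The matrices `A_0 = [[1,0],[1,1]]` and `A_1 = [[0,1],[1,1]]`. -/
def Amat (e : ℤ) : Matrix (Fin 2) (Fin 2) ℤ := !![1 - e, e; 1, 1]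

/-- `Mmat x n = A_{ε_1(x)} ⋯ A_{ε_n(x)}`, with `Mmat x 0` the identity. -/
def Mmat (x : ℝ) : ℕ → Matrix (Fin 2) (Fin 2) ℤ
  | 0 => 1
  | n + 1 => Mmat x n * Amat (eps x n)

/-- `u_n(x)`: top-left entry of `M_n(x)`. -/
def uF (x : ℝ) (n : ℕ) : ℤ := Mmat x n 0 0

/-- `s_n(x)`: bottom-left entry of `M_n(x)`. -/
def sF (x : ℝ) (n : ℕ) : ℤ := Mmat x n 1 0

/-- Ito's natural extension `F̄` of the Farey tent map. -/
def fareyNE (p : ℝ × ℝ) : ℝ × ℝ :=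
  if p.1 ≤ 1/2 then (p.1 / (1 - p.1), p.2 / (1 + p.2))
  else ((1 - p.1) / p.1, 1 / (1 + p.2))

/-- `Ω = [0,1]²`. -/
def OmegaSet : Set (ℝ × ℝ) := Set.Icc (0:ℝ) 1 ×ˢ Set.Icc (0:ℝ) 1

/-- The measure `μ̄` on `Ω` with density `(x + y − xy)⁻²` w.r.t. Lebesgue measure. -/
def muBar : Measure (ℝ × ℝ) :=
  (volume.restrict OmegaSet).withDensity
    (fun p => ENNReal.ofReal (1 / (p.1 + p.2 - p.1 * p.2) ^ 2))

/-- A proper inducible subregion of `Ω`. -/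
def ProperInducible (R : Set (ℝ × ℝ)) : Prop :=
  R ⊆ OmegaSet ∧ MeasurableSet R ∧ 0 < muBar R ∧ muBar R < ⊤ ∧ muBar (frontier R) = 0

/-- `hitsR R x k` holds iff `k ≥ 1` and `F̄^[k] (x,1) ∈ R`. -/
def hitsR (R : Set (ℝ × ℝ)) (x : ℝ) (k : ℕ) : Prop := 1 ≤ k ∧ fareyNE^[k] (x, 1) ∈ R

/-- `Nidx R x n = N_n`: `N_0 = 0` and, for `n ≥ 1`, the `n`-th smallest `k ≥ 1`
with `F̄^[k] (x,1) ∈ R`. -/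
def Nidx (R : Set (ℝ × ℝ)) (x : ℝ) : ℕ → ℕ
  | 0 => 0
  | n + 1 => Nat.nth (hitsR R x) n

/-- `h(x,y) = (1−y)/(x + y − xy)`. -/
def hIto (p : ℝ × ℝ) : ℝ := (1 - p.2) / (p.1 + p.2 - p.1 * p.2)

/-- `Θ_n(x) = s_n(x)·|s_n(x)·x − u_n(x)|`, the approximation coefficient of the
`n`-th Farey convergent `u_n(x)/s_n(x)`. -/
def ThetaF (x : ℝ) (n : ℕ) : ℝ := (sF x n : ℝ) * |(sF x n : ℝ) * x - (uF x n : ℝ)|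

/-- `Θ_n^R(x) = s_n^R·|s_n^R·x − u_n^R|` where `u_n^R = u_{N_n}(x)`, `s_n^R = s_{N_n}(x)`. -/
def ThetaR (R : Set (ℝ × ℝ)) (x : ℝ) (n : ℕ) : ℝ := ThetaF x (Nidx R x n)

/-- The Gauss map. -/
def gaussMap (x : ℝ) : ℝ := Int.fract (1 / x)

/-- `pquot x n` is the RCF partial quotient `a_{n+1}(x)`. -/
def pquot (x : ℝ) (n : ℕ) : ℤ := ⌊1 / (gaussMap^[n] x)⌋

/-- `pnum x (j+1)` is the RCF numerator `p_j(x)`; `pnum x 0 = p_{-1} = 1`. -/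
def pnum (x : ℝ) : ℕ → ℤ
  | 0 => 1
  | 1 => 0
  | n + 2 => pquot x n * pnum x (n + 1) + pnum x n

/-- `qden x (j+1)` is the RCF denominator `q_j(x)`; `qden x 0 = q_{-1} = 0`. -/
def qden (x : ℝ) : ℕ → ℤ
  | 0 => 0
  | 1 => 1
  | n + 2 => pquot x n * qden x (n + 1) + qden x n

/-- The approximation coefficient `Θ(x, p/q) = q·|q·x − p|`. -/
def Theta (x : ℝ) (p q : ℤ) : ℝ := (q : ℝ) * |(q : ℝ) * x - (p : ℝ)|

/-- `medTheta x l j = Θ(x, (l·p_j + p_{j−1})/(l·q_j + q_{j−1}))`. -/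
def medTheta (x : ℝ) (l : ℤ) (j : ℕ) : ℝ :=
  Theta x (l * pnum x (j + 1) + pnum x j) (l * qden x (j + 1) + qden x j)

end

theorem gaussMap_iterate_mem {x : ℝ} (hx : x ∈ Set.Ioo (0:ℝ) 1) (hirr : Irrational x) (n : ℕ) :
    gaussMap^[n] x ∈ Set.Ioo (0:ℝ) 1 ∧ Irrational (gaussMap^[n] x) := by
  induction n with
  | zero => exact ⟨hx, hirr⟩
  | succ n ih =>
    rw [Function.iterate_succ_apply']
    have h : Irrational (gaussMap (gaussMap^[n] x)) := by
      unfold gaussMap Int.fract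
      rw [one_div]
      exact ih.2.inv.sub_intCast _
    refine ⟨⟨lt_of_le_of_ne (Int.fract_nonneg _) h.ne_zero.symm, Int.fract_lt_one _⟩, h⟩

theorem one_le_pquot {x : ℝ} (hx : x ∈ Set.Ioo (0:ℝ) 1) (hirr : Irrational x) (n : ℕ) :
    1 ≤ pquot x n := by
  obtain ⟨⟨h0, h1⟩, -⟩ := gaussMap_iterate_mem hx hirr n
  refine Int.le_floor.mpr ?_
  push_cast
  exact (one_lt_one_div h0 h1).le

theorem pquot_add_gaussMap_iterate (x : ℝ) (n : ℕ) :
    (pquot x n : ℝ) + gaussMap^[n + 1] x = 1 / gaussMap^[n] x := by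
  rw [Function.iterate_succ_apply']
  exact Int.floor_add_fract _

theorem qden_bounds {x : ℝ} (hx : x ∈ Set.Ioo (0:ℝ) 1) (hirr : Irrational x) (n : ℕ) :
    0 ≤ qden x n ∧ qden x n ≤ qden x (n + 1) ∧ 0 < qden x (n + 1) := by
  induction n with
  | zero => simp [qden]
  | succ n ih =>
    obtain ⟨h0, -, h2⟩ := ih
    have ha := one_le_pquot hx hirr n
    have h : qden x (n + 2) = pquot x n * qden x (n + 1) + qden x n := rfl
    refine ⟨h2.le, ?_, ?_⟩ <;> nlinarith

theorem qden_mul_sub_pnum_succ {x : ℝ} (hx : x ∈ Set.Ioo (0:ℝ) 1) (hirr : Irrational x) (n : ℕ) :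
    (qden x (n + 1) : ℝ) * x - pnum x (n + 1) =
      -(gaussMap^[n] x) * ((qden x n : ℝ) * x - pnum x n) := by
  induction n with
  | zero => simp [qden, pnum]
  | succ n ih =>
    obtain ⟨⟨h0, -⟩, -⟩ := gaussMap_iterate_mem hx hirr n
    have ha := pquot_add_gaussMap_iterate x n
    rw [eq_div_iff h0.ne'] at ha
    have hq : qden x (n + 2) = pquot x n * qden x (n + 1) + qden x n := rfl
    have hp : pnum x (n + 2) = pquot x n * pnum x (n + 1) + pnum x n := rfl
    rw [hq, hp]
    push_cast
    linear_combination (pquot x n + gaussMap^[n + 1] x) * ih - (qden x n * x - pnum x n) * ha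

theorem abs_qden_mul_pnum_sub (x : ℝ) (n : ℕ) :
    |qden x (n + 1) * pnum x n - pnum x (n + 1) * qden x n| = 1 := by
  induction n with
  | zero => simp [qden, pnum]
  | succ n ih =>
    have hq : qden x (n + 2) = pquot x n * qden x (n + 1) + qden x n := rfl
    have hp : pnum x (n + 2) = pquot x n * pnum x (n + 1) + pnum x n := rfl
    rw [← ih, hq, hp, ← abs_neg]
    congr 1
    ring

theorem abs_qden_mul_sub_pnum_mul {x : ℝ} (hx : x ∈ Set.Ioo (0:ℝ) 1) (hirr : Irrational x)
    (n : ℕ) :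
    |(qden x n : ℝ) * x - pnum x n| * (qden x (n + 1) + gaussMap^[n] x * qden x n) = 1 := by
  obtain ⟨⟨h0, -⟩, -⟩ := gaussMap_iterate_mem hx hirr n
  obtain ⟨hr, -, hq⟩ := qden_bounds hx hirr n
  have hr' : (0:ℝ) ≤ qden x n := by exact_mod_cast hr
  have hq' : (0:ℝ) < qden x (n + 1) := by exact_mod_cast hq
  have hdet : |(qden x (n + 1) : ℝ) * pnum x n - pnum x (n + 1) * qden x n| = 1 := by
    exact_mod_cast abs_qden_mul_pnum_sub x n
  have hpos : 0 < (qden x (n + 1) : ℝ) + gaussMap^[n] x * qden x n := by positivity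
  rw [← hdet, ← abs_of_pos hpos, ← abs_mul, ← abs_neg]
  congr 1
  linear_combination (-(qden x n : ℝ)) * qden_mul_sub_pnum_succ hx hirr n

/-- Approximation coefficients of the convergent and of the mediants, in terms of
`y = 1 / F` and `s = q_{j-1} / q_j`, where `F` is the `j`-th Gauss iterate of `x`. -/
theorem exists_theta_eq {x : ℝ} (hx : x ∈ Set.Ioo (0:ℝ) 1) (hirr : Irrational x) (j : ℕ) :
    ∃ y s : ℝ, (pquot x j : ℝ) < y ∧ y < pquot x j + 1 ∧ 0 ≤ s ∧ s ≤ 1 ∧ (j ≠ 0 → 0 < s) ∧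
      Theta x (pnum x (j + 1)) (qden x (j + 1)) = 1 / (y + s) ∧
      ∀ l : ℤ, 0 ≤ l → l ≤ pquot x j → medTheta x l j = (l + s) * (y - l) / (y + s) := by
  obtain ⟨⟨h0, -⟩, -⟩ := gaussMap_iterate_mem hx hirr j
  obtain ⟨⟨h0', h1'⟩, -⟩ := gaussMap_iterate_mem hx hirr (j + 1)
  have ha := pquot_add_gaussMap_iterate x j
  obtain ⟨hr, hrq, hq⟩ := qden_bounds hx hirr j
  have hD := qden_mul_sub_pnum_succ hx hirr j
  have hA := abs_qden_mul_sub_pnum_mul hx hirr j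
  have hspos : j ≠ 0 → 0 < qden x j := by
    intro hj
    obtain ⟨k, rfl⟩ := Nat.exists_eq_succ_of_ne_zero hj
    exact (qden_bounds hx hirr k).2.2
  have hr' : (0:ℝ) ≤ qden x j := by exact_mod_cast hr
  have hq' : (0:ℝ) < qden x (j + 1) := by exact_mod_cast hq
  have hrq' : (qden x j : ℝ) ≤ qden x (j + 1) := by exact_mod_cast hrq
  set t := gaussMap^[j] x
  have hpos : 0 < (qden x (j + 1) : ℝ) + t * qden x j := by positivity
  have hA' := eq_one_div_of_mul_eq_one_left hA
  refine ⟨1 / t, qden x j / qden x (j + 1), by linarith, by linarith, by positivity,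
    div_le_one_of_le₀ hrq' hq'.le, fun hj => ?_, ?_, fun l hl0 hl => ?_⟩
  · have : (0:ℝ) < qden x j := by exact_mod_cast hspos hj
    positivity
  · rw [Theta, hD, abs_mul, abs_neg, abs_of_pos h0, hA']
    field_simp
  · have hl' : (l : ℝ) ≤ pquot x j := by exact_mod_cast hl
    have hlt : (l : ℝ) * t ≤ 1 := by
      rw [← le_div_iff₀ h0]
      linarith
    have hfac : ((l * qden x (j + 1) + qden x j : ℤ) : ℝ) * x
        - ((l * pnum x (j + 1) + pnum x j : ℤ) : ℝ) =
        (1 - l * t) * (qden x j * x - pnum x j) := by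
      push_cast
      linear_combination (l : ℝ) * hD
    rw [medTheta, Theta, hfac, abs_mul, abs_of_nonneg (by linarith), hA']
    push_cast
    field_simp

theorem mul_div_add_lt_mul_div_add {u v U V : ℝ} (hu : 0 < u) (hv : 0 < v) (huU : u ≤ U)
    (hvV : v < V) : u * v / (u + v) < U * V / (U + V) := by
  have hU : 0 < U := hu.trans_le huU
  have hV : 0 < V := hv.trans hvV
  rw [div_lt_div_iff₀ (by positivity) (by positivity)]
  nlinarith [mul_nonneg (mul_pos hv hV).le (sub_nonneg.2 huU),
    mul_pos (mul_pos hu hU) (sub_pos.2 hvV)]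

theorem succ_mul_succ_sub_div_le (a l : ℤ) (ha : 0 ≤ a) :
    ((l:ℝ) + 1) * (a + 1 - l) / (a + 2) ≤
      if Even a then ((a:ℝ) + 2) / 4 else ((a:ℝ) + 1) * ((a:ℝ) + 3) / (4 * ((a:ℝ) + 2)) := by
  have ha' : (0:ℝ) ≤ a := by exact_mod_cast ha
  split_ifs with h
  · rw [div_le_div_iff₀ (by positivity) (by positivity)]
    nlinarith [sq_nonneg ((a:ℝ) - 2 * l)]
  · have hodd : 1 ≤ (a - 2 * l) ^ 2 := by
      rw [one_le_sq_iff_one_le_abs]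
      refine Int.one_le_abs fun h0 => h ⟨l, by linarith⟩
    have hodd' : (1:ℝ) ≤ ((a:ℝ) - 2 * l) ^ 2 := by exact_mod_cast hodd
    rw [mul_comm (4:ℝ), ← div_div, div_right_comm]
    refine div_le_div_of_nonneg_right ?_ (by positivity)
    rw [le_div_iff₀ (by norm_num)]
    nlinarith

/-- The approximation coefficients of the mediants between `p_{j−1}/q_{j−1}` and `p_j/q_j`
first increase then decrease, with the stated optimal bounds. -/
theorem stmt_16 (x : ℝ) (hx : x ∈ Set.Ioo (0:ℝ) 1) (hirr : Irrational x)
    (j : ℕ) (ha : 2 ≤ pquot x j) :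
    let a : ℤ := pquot x j
    let Th : ℤ → ℝ := fun lam =>
      if lam = a then Theta x (pnum x (j + 1)) (qden x (j + 1)) else medTheta x lam j
    (∀ lam : ℤ, 0 ≤ lam → lam ≤ a → ¬(j = 0 ∧ lam = 0) →
        0 < Th lam ∧
        Th lam < (if Even a then ((a:ℝ) + 2) / 4
                  else ((a:ℝ) + 1) * ((a:ℝ) + 3) / (4 * ((a:ℝ) + 2)))) ∧
    (∀ lam lam' : ℤ, 0 ≤ lam → lam < lam' → lam' ≤ a / 2 → Th lam < Th lam') ∧
    (∀ lam lam' : ℤ, (a + 1) / 2 ≤ lam → lam < lam' → lam' < a →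
        Th lam > Th lam' ∧ Th lam' > Theta x (pnum x (j + 1)) (qden x (j + 1))) := by
  intro a Th
  obtain ⟨y, s, hay, hya, hs0, hs1, hs, hTa, hTm⟩ := exists_theta_eq hx hirr j
  have ha' : (2:ℝ) ≤ pquot x j := by exact_mod_cast ha
  have hys : 0 < y + s := by linarith
  have hTh : ∀ l : ℤ, 0 ≤ l → l < a → Th l = (l + s) * (y - l) / (y + s) := fun l h0 h1 => by
    simp only [Th, if_neg h1.ne, hTm l h0 h1.le]
  refine ⟨fun l h0 h1 hne => ?_, fun l l' h0 hlt hle => ?_, fun l l' h0 hlt hle => ?_⟩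
  · rcases h1.eq_or_lt with rfl | h1
    · have hThl : Th a = 1 / (y + s) := by simp only [Th, if_true, hTa]
      rw [hThl]
      refine ⟨by positivity, lt_of_lt_of_le ?_ (succ_mul_succ_sub_div_le a 0 (by omega))⟩
      have haa : (2:ℝ) ≤ a := ha'
      rw [div_lt_div_iff₀ hys (by positivity)]
      have hy2 : (a:ℝ) < y := hay
      push_cast
      nlinarith
    · have h1' : (l:ℝ) + 1 ≤ pquot x j := by exact_mod_cast h1
      have h0' : (0:ℝ) ≤ l := by exact_mod_cast h0
      have hu : 0 < (l:ℝ) + s := by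
        by_cases hj : j = 0
        · have : (0:ℝ) < l := by exact_mod_cast lt_of_le_of_ne h0 fun h => hne ⟨hj, h.symm⟩
          linarith
        · linarith [hs hj]
      have hv : 0 < y - l := by linarith
      rw [hTh l h0 h1]
      refine ⟨by positivity, lt_of_lt_of_le ?_ (succ_mul_succ_sub_div_le a l (by omega))⟩
      have key := mul_div_add_lt_mul_div_add hu hv (by linarith : (l:ℝ) + s ≤ l + 1)
        (by simp only [a]; linarith : y - l < a + 1 - l)
      rwa [show (l:ℝ) + s + (y - l) = y + s by ring,
        show (l:ℝ) + 1 + (a + 1 - l) = a + 2 by ring] at key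
  · have hsum : l + l' + 1 ≤ a := by omega
    have hsum' : (l:ℝ) + l' + 1 ≤ pquot x j := by exact_mod_cast hsum
    have hlt' : (l:ℝ) < l' := by exact_mod_cast hlt
    rw [hTh l h0 (by omega), hTh l' (by omega) (by omega)]
    refine div_lt_div_of_pos_right ?_ hys
    nlinarith [mul_pos (sub_pos.2 hlt') (by linarith : 0 < y - s - l - l')]
  · have hsum : a + 1 ≤ l + l' := by omega
    have hsum' : (pquot x j : ℝ) + 1 ≤ l + l' := by exact_mod_cast hsum
    have hlt' : (l:ℝ) < l' := by exact_mod_cast hlt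
    have hle' : (l':ℝ) + 1 ≤ pquot x j := by exact_mod_cast hle
    have hl' : (1:ℝ) ≤ l' := by exact_mod_cast (by omega : 1 ≤ l')
    rw [hTh l (by omega) (by omega), hTh l' (by omega) hle, hTa]
    refine ⟨div_lt_div_of_pos_right ?_ hys, div_lt_div_of_pos_right ?_ hys⟩
    · nlinarith [mul_pos (sub_pos.2 hlt') (by linarith : 0 < l + l' + s - y)]
    · nlinarith
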